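/- The set B = {φ₁+φ₂+φ₃, −(φ₁+φ₂), φ₂, φ₄} is a base of Δ, and the positive system determined by B equals Δ_k⁺ ∪ {β ∈ Δ_n⁺ : β ≥ φ₁+φ₂+φ₃} ∪ (−{β ∈ Δ_n⁺ : β ≤ φ₁+φ₂}); in particular this positive system contains Δ_k⁺. -/

import Mathlib

noncomputable section

abbrev V : Type := Fin 4 → ℝ

def e (i : Fin 4) : V := Pi.single i 1

/-- The root system of type F₄ in ℝ⁴ (48 vectors). -/
def Δ : Set V :=
  (⋃ i, ({e i, -e i} : Set V)) ∪
  (⋃ (i) (j) (_ : i < j), ({e i + e j, e i - e j, -e i + e j, -e i - e j} : Set V)) ∪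
  {v | ∃ s : Fin 4 → ℝ, (∀ i, s i = 1 ∨ s i = -1) ∧ v = (1 / 2 : ℝ) • ∑ i, s i • e i}

def φ₁ : V := e 1 - e 2
def φ₂ : V := e 2 - e 3
def φ₃ : V := e 3
def φ₄ : V := (1 / 2 : ℝ) • (e 0 - e 1 - e 2 - e 3)

def φv : Fin 4 → V := ![φ₁, φ₂, φ₃, φ₄]

/-- The coordinates `n₁(α), …, n₄(α)` of `α` with respect to the basis φ₁,…,φ₄:
for every `α : V` one has `α = ∑ i, n α i • φv i`. -/
def n (α : V) : Fin 4 → ℝ :=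
  ![α 1 + α 0, α 1 + α 2 + 2 * α 0, α 1 + α 2 + α 3 + 3 * α 0, 2 * α 0]

/-- The highest root δ = 2φ₁+3φ₂+4φ₃+2φ₄ = e₁+e₂. -/
def δ : V := e 0 + e 1

/-- Compact roots: roots α with n₁(α) even. -/
def Δk : Set V := {α ∈ Δ | ∃ m : ℤ, n α 0 = 2 * m}

/-- Noncompact roots: roots α with n₁(α) odd. -/
def Δn : Set V := {α ∈ Δ | ∃ m : ℤ, n α 0 = 2 * m + 1}

/-- Δ⁺: roots with all φ-coefficients nonnegative. -/
def Δp : Set V := {α ∈ Δ | ∀ i, 0 ≤ n α i}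

def Δkp : Set V := Δp ∩ Δk
def Δnp : Set V := Δp ∩ Δn

/-- A positive system of Δ: the set of roots on which some root-regular linear
functional is positive. -/
def IsPosSystem (P : Set V) : Prop :=
  ∃ f : V →ₗ[ℝ] ℝ, (∀ α ∈ Δ, f α ≠ 0) ∧ P = {α ∈ Δ | 0 < f α}

/-- `le' γ β` means γ ≤ β, i.e. β − γ is a nonnegative integer combination of φ₁,…,φ₄. -/
def le' (γ β : V) : Prop := ∃ c : Fin 4 → ℕ, β - γ = ∑ i, (c i : ℝ) • φv i

/-- A base of Δ: a linearly independent subset of Δ such that every root is an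
integral combination with coefficients all ≥ 0 or all ≤ 0. -/
def IsBase (B : Finset V) : Prop :=
  ↑B ⊆ Δ ∧ LinearIndependent ℝ (Subtype.val : {x : V // x ∈ B} → V) ∧
  ∀ α ∈ Δ, ∃ c : V → ℤ,
    α = ∑ x ∈ B, (c x : ℝ) • x ∧ ((∀ x ∈ B, 0 ≤ c x) ∨ (∀ x ∈ B, c x ≤ 0))

/-- The positive system determined by a base B: roots whose B-coefficients are all ≥ 0. -/
def posOf (B : Finset V) : Set V :=
  {α ∈ Δ | ∃ c : V → ℤ, α = ∑ x ∈ B, (c x : ℝ) • x ∧ ∀ x ∈ B, 0 ≤ c x}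

theorem sum_phi_apply (w : Fin 4 → ℝ) :
    ∑ i, w i • φv i =
      ![w 3 / 2, w 0 - w 3 / 2, w 1 - w 0 - w 3 / 2, w 2 - w 1 - w 3 / 2] := by
  ext k
  fin_cases k <;> simp [Fin.sum_univ_four, φv, φ₁, φ₂, φ₃, φ₄, e] <;> ring

theorem sum_n_smul (α : V) : ∑ i, n α i • φv i = α := by
  rw [sum_phi_apply]
  ext k
  fin_cases k <;> simp [n] <;> ring

theorem n_sum_phi (w : Fin 4 → ℝ) : n (∑ i, w i • φv i) = w := by
  rw [sum_phi_apply]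
  ext k
  fin_cases k <;> simp [n] <;> ring

theorem n_sub (α β : V) : n (α - β) = n α - n β := by
  ext k
  fin_cases k <;> simp [n] <;> ring

theorem n_neg (α : V) : n (-α) = -n α := by
  ext k
  fin_cases k <;> simp [n] <;> ring

theorem n_injective : Function.Injective n := fun α β h => by
  rw [← sum_n_smul α, h, sum_n_smul]

theorem le'_iff (γ β : V) : le' γ β ↔ ∀ i, ∃ c : ℕ, n β i - n γ i = c := by
  refine Iff.trans ?_ Classical.skolem.symm
  refine exists_congr fun c => ?_
  rw [← n_injective.eq_iff, n_sum_phi, n_sub, funext_iff]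
  rfl

/-- Twice a root is an integer vector with entries of equal parity and squared length 4 or 8. -/
theorem exists_double {α : V} (hα : α ∈ Δ) :
    ∃ d : Fin 4 → ℤ, (∀ i, α i = d i / 2) ∧ (∀ i, d i ∈ Finset.Icc (-2) 2) ∧
      (∀ i, d i % 2 = d 0 % 2) ∧ (∑ i, d i ^ 2 = 4 ∨ ∑ i, d i ^ 2 = 8) := by
  rcases hα with (h | h) | ⟨s, hs, rfl⟩
  · simp only [Set.mem_iUnion, Set.mem_insert_iff, Set.mem_singleton_iff] at h
    obtain ⟨i, rfl | rfl⟩ := h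
    · refine ⟨Pi.single i 2, fun k => ?_, ?_⟩
      · by_cases h : k = i <;> simp [e, h]
      · revert i; decide
    · refine ⟨-Pi.single i 2, fun k => ?_, ?_⟩
      · by_cases h : k = i <;> simp [e, h]
      · revert i; decide
  · simp only [Set.mem_iUnion, Set.mem_insert_iff, Set.mem_singleton_iff] at h
    obtain ⟨i, j, hij, rfl | rfl | rfl | rfl⟩ := h
    · refine ⟨Pi.single i 2 + Pi.single j 2, fun k => ?_, ?_⟩
      · simp only [e, Pi.add_apply, Pi.single_apply]; split_ifs <;> norm_num
      · revert i j; decide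
    · refine ⟨Pi.single i 2 - Pi.single j 2, fun k => ?_, ?_⟩
      · simp only [e, Pi.sub_apply, Pi.single_apply]; split_ifs <;> norm_num
      · revert i j; decide
    · refine ⟨-Pi.single i 2 + Pi.single j 2, fun k => ?_, ?_⟩
      · simp only [e, Pi.add_apply, Pi.neg_apply, Pi.single_apply]; split_ifs <;> norm_num
      · revert i j; decide
    · refine ⟨-Pi.single i 2 - Pi.single j 2, fun k => ?_, ?_⟩
      · simp only [e, Pi.sub_apply, Pi.neg_apply, Pi.single_apply]; split_ifs <;> norm_num
      · revert i j; decide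
  · have hσ : ∀ i, ∃ t : ℤ, s i = t ∧ (t = 1 ∨ t = -1) := fun i =>
      (hs i).elim (fun h => ⟨1, by simp [h]⟩) (fun h => ⟨-1, by simp [h]⟩)
    choose t hst ht using hσ
    have hodd : ∀ i, t i % 2 = 1 := fun i => by rcases ht i with h | h <;> simp [h]
    have hsq : ∀ i, t i ^ 2 = 1 := fun i => by rcases ht i with h | h <;> simp [h]
    refine ⟨t, fun k => ?_, fun i => ?_, fun i => by rw [hodd, hodd], Or.inl (by simp [hsq])⟩
    · fin_cases k <;> simp [Fin.sum_univ_four, e, hst] <;> ring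
    · rcases ht i with h | h <;> simp [h]

/-- The sign conditions relating `φ`-coordinates `(p, q, r, s)` of a root to its coordinates
`(r, r - p, q - p, s)` in the new base. -/
def SignRule (p q r s : ℤ) : Prop :=
  ((0 ≤ r ∧ p ≤ r ∧ p ≤ q ∧ 0 ≤ s) ∨ (r ≤ 0 ∧ r ≤ p ∧ q ≤ p ∧ s ≤ 0)) ∧
  ((0 ≤ r ∧ p ≤ r ∧ p ≤ q ∧ 0 ≤ s) ↔
    ((0 ≤ p ∧ 0 ≤ q ∧ 0 ≤ r ∧ 0 ≤ s) ∧ p % 2 = 0) ∨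
    (p % 2 = 1 ∧ 1 ≤ p ∧ 1 ≤ q ∧ 1 ≤ r ∧ 0 ≤ s) ∨
    (p % 2 = 1 ∧ (-1 ≤ p ∧ p ≤ 0) ∧ (-1 ≤ q ∧ q ≤ 0) ∧ r = 0 ∧ s = 0))

instance (p q r s : ℤ) : Decidable (SignRule p q r s) := by
  unfold SignRule; infer_instance

theorem signRule_of_double :
    ∀ a ∈ Finset.Icc (-2 : ℤ) 2, ∀ b ∈ Finset.Icc (-2 : ℤ) 2, ∀ c ∈ Finset.Icc (-2 : ℤ) 2,
    ∀ d ∈ Finset.Icc (-2 : ℤ) 2, b % 2 = a % 2 → c % 2 = a % 2 → d % 2 = a % 2 →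
    (a ^ 2 + b ^ 2 + c ^ 2 + d ^ 2 = 4 ∨ a ^ 2 + b ^ 2 + c ^ 2 + d ^ 2 = 8) →
    SignRule ((a + b) / 2) ((2 * a + b + c) / 2) ((3 * a + b + c + d) / 2) a := by
  decide +kernel

theorem exists_coords {α : V} (hα : α ∈ Δ) :
    ∃ p q r s : ℤ, n α = ![(p : ℝ), q, r, s] ∧ SignRule p q r s := by
  obtain ⟨d, hd, hI, hpar, hsq⟩ := exists_double hα
  rw [Fin.sum_univ_four] at hsq
  refine ⟨_, _, _, _, ?_, signRule_of_double _ (hI 0) _ (hI 1) _ (hI 2) _ (hI 3)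
    (hpar 1) (hpar 2) (hpar 3) hsq⟩
  have h1 := hpar 1
  have h2 := hpar 2
  have h3 := hpar 3
  obtain ⟨x, hx⟩ : (2 : ℤ) ∣ d 0 + d 1 := by omega
  obtain ⟨y, hy⟩ : (2 : ℤ) ∣ 2 * d 0 + d 1 + d 2 := by omega
  obtain ⟨z, hz⟩ : (2 : ℤ) ∣ 3 * d 0 + d 1 + d 2 + d 3 := by omega
  rw [hx, hy, hz]
  simp only [Int.mul_ediv_cancel_left _ (two_ne_zero' ℤ)]
  have hx' : (d 0 + d 1 : ℝ) = 2 * x := mod_cast hx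
  have hy' : (2 * d 0 + d 1 + d 2 : ℝ) = 2 * y := mod_cast hy
  have hz' : (3 * d 0 + d 1 + d 2 + d 3 : ℝ) = 2 * z := mod_cast hz
  ext k
  fin_cases k <;> simp [n, hd] <;> linarith

theorem neg_mem_Δ {α : V} (hα : α ∈ Δ) : -α ∈ Δ := by
  rcases hα with (h | h) | ⟨s, hs, rfl⟩
  · refine Or.inl (Or.inl ?_)
    simp only [Set.mem_iUnion, Set.mem_insert_iff, Set.mem_singleton_iff] at h ⊢
    obtain ⟨i, rfl | rfl⟩ := h <;> exact ⟨i, by simp⟩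
  · refine Or.inl (Or.inr ?_)
    simp only [Set.mem_iUnion, Set.mem_insert_iff, Set.mem_singleton_iff] at h ⊢
    obtain ⟨i, j, hij, h⟩ := h
    refine ⟨i, j, hij, ?_⟩
    rcases h with rfl | rfl | rfl | rfl
    · exact Or.inr (Or.inr (Or.inr (by abel)))
    · exact Or.inr (Or.inr (Or.inl (by abel)))
    · exact Or.inr (Or.inl (by abel))
    · exact Or.inl (by abel)
  · refine Or.inr ⟨-s, fun i => ?_, ?_⟩
    · rcases hs i with h | h <;> simp [h]
    · simp

/-- The base of the statement, as an indexed family. -/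
def newBase : Fin 4 → V := ![φ₁ + φ₂ + φ₃, -(φ₁ + φ₂), φ₂, φ₄]

theorem coe_newBase :
    ({φ₁ + φ₂ + φ₃, -(φ₁ + φ₂), φ₂, φ₄} : Finset V) = Finset.univ.image newBase := by
  ext x
  simp [newBase, Fin.exists_fin_succ, eq_comm]

theorem n_sum_newBase (m : Fin 4 → ℝ) :
    n (∑ i, m i • newBase i) = ![m 0 - m 1, m 0 - m 1 + m 2, m 0, m 3] := by
  ext k
  fin_cases k <;>
    simp [Fin.sum_univ_four, newBase, n, φ₁, φ₂, φ₃, φ₄, e] <;> ring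

theorem linearIndependent_newBase : LinearIndependent ℝ newBase := by
  rw [Fintype.linearIndependent_iff]
  intro g hg
  have h := n_sum_newBase g
  rw [hg] at h
  have h0 := congrFun h 0
  have h1 := congrFun h 1
  have h2 := congrFun h 2
  have h3 := congrFun h 3
  simp [n] at h0 h1 h2 h3
  intro i
  fin_cases i <;> simp <;> linarith

theorem exists_coeff_image_iff {ι M : Type*} [Fintype ι] [DecidableEq M] [AddCommGroup M]
    [Module ℝ M] {b : ι → M} (hb : Function.Injective b) (α : M) (Q : (ι → ℤ) → Prop) :
    (∃ c : M → ℤ, α = ∑ x ∈ Finset.univ.image b, (c x : ℝ) • x ∧ Q (c ∘ b)) ↔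
      ∃ m : ι → ℤ, α = ∑ i, (m i : ℝ) • b i ∧ Q m := by
  simp only [Finset.sum_image hb.injOn]
  constructor
  · rintro ⟨c, h, hQ⟩
    exact ⟨c ∘ b, h, hQ⟩
  · rintro ⟨m, h, hQ⟩
    refine ⟨Function.extend b m 0, ?_, ?_⟩
    · simpa only [hb.extend_apply] using h
    · rwa [Function.extend_comp hb]

theorem eq_sum_newBase_iff {α : V} {p q r s : ℤ} (h : n α = ![(p : ℝ), q, r, s])
    (m : Fin 4 → ℤ) :
    α = ∑ i, (m i : ℝ) • newBase i ↔ m = ![r, r - p, q - p, s] := by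
  rw [← n_injective.eq_iff, h, n_sum_newBase (fun i => (m i : ℝ))]
  simp only [funext_iff, Fin.forall_fin_succ, IsEmpty.forall_iff]
  simp
  norm_cast
  omega

theorem newBase_mem_Δ (i : Fin 4) : newBase i ∈ Δ := by
  fin_cases i
  · refine Or.inl (Or.inl (Set.mem_iUnion.2 ⟨1, Or.inl ?_⟩))
    simp [newBase, φ₁, φ₂, φ₃]
  · refine neg_mem_Δ (Or.inl (Or.inr ?_))
    simp only [Set.mem_iUnion]
    exact ⟨1, 3, by decide, Or.inr (Or.inl (by simp [φ₁, φ₂]))⟩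
  · refine Or.inl (Or.inr ?_)
    simp only [Set.mem_iUnion]
    exact ⟨2, 3, by decide, Or.inr (Or.inl rfl)⟩
  · refine Or.inr ⟨![1, -1, -1, -1], fun i => by fin_cases i <;> simp, ?_⟩
    simp [newBase, φ₄, Fin.sum_univ_four, sub_eq_add_neg]

theorem isBase_newBase : IsBase (Finset.univ.image newBase) := by
  refine ⟨?_, ?_, fun α hα => ?_⟩
  · simpa [Set.range_subset_iff] using newBase_mem_Δ
  · have h := linearIndependent_newBase.linearIndepOn_id
    rw [← Set.image_univ, ← Finset.coe_univ, ← Finset.coe_image] at h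
    exact h
  · obtain ⟨p, q, r, s, hn, hsign, -⟩ := exists_coords hα
    simp only [Finset.forall_mem_image, Finset.mem_univ, forall_const]
    refine (exists_coeff_image_iff linearIndependent_newBase.injective α
      (fun m => (∀ i, 0 ≤ m i) ∨ ∀ i, m i ≤ 0)).2 ⟨_, (eq_sum_newBase_iff hn _).2 rfl, ?_⟩
    simpa [Fin.forall_fin_succ] using hsign

theorem mem_posOf_newBase_iff {α : V} (hα : α ∈ Δ) {p q r s : ℤ}
    (h : n α = ![(p : ℝ), q, r, s]) :
    α ∈ posOf (Finset.univ.image newBase) ↔ 0 ≤ r ∧ p ≤ r ∧ p ≤ q ∧ 0 ≤ s := by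
  have key := exists_coeff_image_iff linearIndependent_newBase.injective α
    (fun m => ∀ i, 0 ≤ m i)
  simp only [eq_sum_newBase_iff h, exists_eq_left] at key
  simp only [posOf, Set.mem_ofPred_eq, hα, true_and, Finset.forall_mem_image, Finset.mem_univ,
    forall_const]
  refine key.trans ?_
  simp [Fin.forall_fin_succ]

theorem mem_Δkp_iff {α : V} (hα : α ∈ Δ) {p q r s : ℤ} (h : n α = ![(p : ℝ), q, r, s]) :
    α ∈ Δkp ↔ (0 ≤ p ∧ 0 ≤ q ∧ 0 ≤ r ∧ 0 ≤ s) ∧ p % 2 = 0 := by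
  simp only [Δkp, Δp, Δk, Set.mem_inter_iff, Set.mem_ofPred_eq, hα, true_and, h,
    Fin.forall_fin_succ]
  simp
  intros
  norm_cast

theorem mem_Δnp_iff {α : V} (hα : α ∈ Δ) {p q r s : ℤ} (h : n α = ![(p : ℝ), q, r, s]) :
    α ∈ Δnp ↔ (0 ≤ p ∧ 0 ≤ q ∧ 0 ≤ r ∧ 0 ≤ s) ∧ p % 2 = 1 := by
  simp only [Δnp, Δp, Δn, Set.mem_inter_iff, Set.mem_ofPred_eq, hα, true_and, h,
    Fin.forall_fin_succ]
  simp
  intros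
  norm_cast
  exact ⟨fun ⟨m, hm⟩ => by omega, fun h => ⟨p / 2, by omega⟩⟩

theorem exists_intCast_eq_natCast_iff (k : ℤ) : (∃ c : ℕ, (k : ℝ) = c) ↔ 0 ≤ k := by
  refine ⟨fun ⟨c, hc⟩ => ?_, fun h => ⟨k.toNat, ?_⟩⟩
  · have : k = c := mod_cast hc
    omega
  · exact_mod_cast (Int.toNat_of_nonneg h).symm

theorem le'_iff_of_coords {γ β : V} {p q r s p' q' r' s' : ℤ}
    (hγ : n γ = ![(p : ℝ), q, r, s]) (hβ : n β = ![(p' : ℝ), q', r', s']) :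
    le' γ β ↔ p ≤ p' ∧ q ≤ q' ∧ r ≤ r' ∧ s ≤ s' := by
  simp only [le'_iff, hγ, hβ, Fin.forall_fin_succ]
  simp [← Int.cast_sub, exists_intCast_eq_natCast_iff]

theorem n_phi_one_two_three :
    n (φ₁ + φ₂ + φ₃) = ![((1 : ℤ) : ℝ), (1 : ℤ), (1 : ℤ), (0 : ℤ)] := by
  ext k
  fin_cases k <;> simp [n, φ₁, φ₂, φ₃, e]

theorem n_phi_one_two : n (φ₁ + φ₂) = ![((1 : ℤ) : ℝ), (1 : ℤ), (0 : ℤ), (0 : ℤ)] := by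
  ext k
  fin_cases k <;> simp [n, φ₁, φ₂, e]

theorem posOf_newBase :
    posOf (Finset.univ.image newBase) =
      Δkp ∪ {β ∈ Δnp | le' (φ₁ + φ₂ + φ₃) β} ∪ (Neg.neg '' {β ∈ Δnp | le' β (φ₁ + φ₂)}) := by
  ext α
  by_cases hα : α ∈ Δ
  · obtain ⟨p, q, r, s, hn, -, hiff⟩ := exists_coords hα
    have hn' : n (-α) = ![((-p : ℤ) : ℝ), (-q : ℤ), (-r : ℤ), (-s : ℤ)] := by
      rw [n_neg, hn]; simp
    rw [mem_posOf_newBase_iff hα hn, hiff]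
    simp only [Set.image_neg_eq_neg, Set.mem_union, Set.mem_neg, Set.mem_ofPred_eq,
      mem_Δkp_iff hα hn, mem_Δnp_iff hα hn, mem_Δnp_iff (neg_mem_Δ hα) hn',
      le'_iff_of_coords n_phi_one_two_three hn, le'_iff_of_coords hn' n_phi_one_two]
    omega
  · refine iff_of_false (fun h => hα h.1) ?_
    rintro ((h | h) | ⟨β, h, rfl⟩)
    · exact hα h.1.1
    · exact hα h.1.1.1
    · exact hα (neg_mem_Δ h.1.1.1)

theorem stmt7 :
    IsBase ({φ₁ + φ₂ + φ₃, -(φ₁ + φ₂), φ₂, φ₄} : Finset V) ∧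
    posOf ({φ₁ + φ₂ + φ₃, -(φ₁ + φ₂), φ₂, φ₄} : Finset V) =
      Δkp ∪ {β ∈ Δnp | le' (φ₁ + φ₂ + φ₃) β} ∪ (Neg.neg '' {β ∈ Δnp | le' β (φ₁ + φ₂)}) ∧
    Δkp ⊆ posOf ({φ₁ + φ₂ + φ₃, -(φ₁ + φ₂), φ₂, φ₄} : Finset V) := by
  rw [coe_newBase]
  refine ⟨isBase_newBase, posOf_newBase, ?_⟩
  rw [posOf_newBase]
  exact fun α hα => Or.inl (Or.inl hα)
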